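/- Let E be a real inner product space, let F ⊆ E be a nonempty convex set, let v ∈ E, and let p be a point in the intrinsic (relative) interior of F, i.e., the interior of F within its affine span. Suppose that ‖v − p‖ ≤ ‖v − x‖ for all x ∈ F. Then ‖v − p‖ ≤ ‖v − x‖ for all x in the affine span of F; that is, p is the point of the affine span of F nearest to v. -/

import Mathlib

/-- From a point of the intrinsic interior of `F` one can move a positive amount towards any point
of the affine span while staying in `F`. -/
theorem exists_lineMap_mem_of_mem_intrinsicInterior
    {E : Type*} [NormedAddCommGroup E] [NormedSpace ℝ E] {F : Set E} {p x : E}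
    (hp : p ∈ intrinsicInterior ℝ F) (hx : x ∈ affineSpan ℝ F) :
    ∃ t : ℝ, 0 < t ∧ t < 1 ∧ AffineMap.lineMap p x t ∈ F := by
  obtain ⟨q, hq, rfl⟩ := mem_intrinsicInterior.1 hp
  let g : ℝ → affineSpan ℝ F := fun t =>
    ⟨AffineMap.lineMap (q : E) x t, AffineMap.lineMap_mem t q.2 hx⟩
  have hg : Continuous g := AffineMap.lineMap_continuous.subtype_mk _
  have hg0 : g 0 = q := Subtype.ext (AffineMap.lineMap_apply_zero _ _)
  have hev : ∀ᶠ t in nhds (0 : ℝ), g t ∈ ((↑) ⁻¹' F : Set (affineSpan ℝ F)) :=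
    hg.continuousAt.eventually_mem (by rw [hg0]; exact mem_interior_iff_mem_nhds.1 hq)
  obtain ⟨t, htF, ht⟩ := ((hev.filter_mono nhdsWithin_le_nhds).and
    (Ioo_mem_nhdsGT (zero_lt_one' ℝ))).exists
  exact ⟨t, ht.1, ht.2, htF⟩

/-- If `p` lies in the intrinsic (relative) interior of a nonempty convex set
`F` in a real inner product space and `p` minimizes the distance to `v` over `F`, then `p`
minimizes the distance to `v` over the whole affine span of `F`. -/
theorem nearest_point_in_relative_interior_is_projection_to_span
    {E : Type*} [NormedAddCommGroup E] [InnerProductSpace ℝ E]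
    (F : Set E) (hF : Convex ℝ F) (hFne : F.Nonempty)
    (v p : E) (hp : p ∈ intrinsicInterior ℝ F)
    (hmin : ∀ x ∈ F, ‖v - p‖ ≤ ‖v - x‖) :
    ∀ x ∈ (affineSpan ℝ F : Set E), ‖v - p‖ ≤ ‖v - x‖ := by
  intro x hx
  obtain ⟨t, ht0, ht1, htF⟩ := exists_lineMap_mem_of_mem_intrinsicInterior hp hx
  have hconv : ‖v - AffineMap.lineMap p x t‖ ≤ (1 - t) * ‖v - p‖ + t * ‖v - x‖ := by
    have heq : v - AffineMap.lineMap p x t = (1 - t) • (v - p) + t • (v - x) := by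
      rw [AffineMap.lineMap_apply_module]
      module
    rw [heq]
    refine (norm_add_le _ _).trans_eq ?_
    rw [norm_smul_of_nonneg (sub_nonneg.2 ht1.le), norm_smul_of_nonneg ht0.le]
  have hle := (hmin _ htF).trans hconv
  exact le_of_mul_le_mul_left (by linarith) ht0
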